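/- arXiv:1602.08565 — 6 statements merged into one kernel-verified Lean document; each statement's English description precedes it below -/
import Mathlib

section
/- Let Σ be a type and let v₁, w₁, v₂, w₂ be words over Σ. If del(v₁, w₁) ≠ del(v₁ ++ v₂, w₁ ++ w₂) (as elements of FreeGroup Σ), then for all natural numbers i < j, del(v₁ ++ v₂^i, w₁ ++ w₂^i) ≠ del(v₁ ++ v₂^j, w₁ ++ w₂^j), where v₂^i denotes the i-fold concatenation of v₂ with itself. -/
/-- The canonical map sending a word to the product of the free-group
generators of its letters. -/
def iota {α : Type*} (w : List α) : FreeGroup α :=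
  (w.map FreeGroup.of).prod

/-- The delay between two words `u` and `v`. -/
def del {α : Type*} (u v : List α) : FreeGroup α :=
  (iota u)⁻¹ * iota v

/-- The `i`-fold concatenation of a word with itself. -/
def wpow {α : Type*} (w : List α) (i : ℕ) : List α :=
  (List.replicate i w).flatten

theorem iota_append_aux {α : Type*} (u v : List α) : iota (u ++ v) = iota u * iota v := by
  simp [iota]

theorem iota_wpow_aux {α : Type*} (u : List α) (i : ℕ) : iota (wpow u i) = iota u ^ i := by
  induction i with
  | zero => simp [iota, wpow]
  | succ n ih =>
    have : wpow u (n + 1) = u ++ wpow u n := by simp [wpow, List.replicate_succ]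
    rw [this, iota_append_aux, ih, pow_succ']

theorem delay_folklore {α : Type*} (v₁ w₁ v₂ w₂ : List α)
    (h : del v₁ w₁ ≠ del (v₁ ++ v₂) (w₁ ++ w₂)) :
    ∀ i j : ℕ, i < j →
      del (v₁ ++ wpow v₂ i) (w₁ ++ wpow w₂ i) ≠
        del (v₁ ++ wpow v₂ j) (w₁ ++ wpow w₂ j) := by
  intro i j hij heq
  apply h
  obtain ⟨k, hk, rfl⟩ : ∃ k, k ≠ 0 ∧ j = k + i := ⟨j - i, by omega, by omega⟩
  simp only [del, iota_append_aux, iota_wpow_aux, mul_inv_rev] at heq ⊢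
  generalize iota v₁ = a at *
  generalize iota w₁ = b at *
  generalize iota v₂ = x at *
  generalize iota w₂ = y at *
  rw [pow_add y, add_comm k i, pow_add x, mul_inv_rev] at heq
  have h1 : a⁻¹ * b = (x ^ k)⁻¹ * (a⁻¹ * b) * y ^ k := by
    have hc : Commute (x ^ i)⁻¹ (x ^ k)⁻¹ := (Commute.pow_pow_self x i k).inv_inv
    rw [← hc.eq] at heq
    have h2 : (x ^ i)⁻¹ * (a⁻¹ * b) * y ^ i
        = (x ^ i)⁻¹ * ((x ^ k)⁻¹ * (a⁻¹ * b) * y ^ k) * y ^ i := by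
      simpa only [mul_assoc] using heq
    exact mul_left_cancel (mul_right_cancel h2)
  have h3 : x ^ k = ((a⁻¹ * b) * y * (a⁻¹ * b)⁻¹) ^ k := by
    rw [conj_pow, eq_mul_inv_iff_mul_eq]
    nth_rewrite 1 [h1]
    group
  have h4 := IsMulTorsionFree.pow_left_injective hk h3
  rw [h4]
  group
end

section
/- Let Σ be a type, let v₁, w₁ be words over Σ such that neither v₁ is a prefix of w₁ nor w₁ is a prefix of v₁, and let v₂, w₂ be words over Σ that are not both empty. Then for all natural numbers i < j, del(v₁ ++ v₂^i, w₁ ++ w₂^i) ≠ del(v₁ ++ v₂^j, w₁ ++ w₂^j), where v₂^i denotes the i-fold concatenation of v₂ with itself. -/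
theorem iota_eq {α : Type*} (w : List α) :
    iota w = FreeGroup.mk (w.map fun a => (a, true)) := by
  induction w with
  | nil => rfl
  | cons a w ih =>
    have : iota (a :: w) = FreeGroup.of a * iota w := by simp [iota]
    rw [this, ih]; rfl

theorem del_append {α : Type*} (p u v : List α) : del (p ++ u) (p ++ v) = del u v := by
  simp [del, iota, mul_assoc]

theorem wpow_length {α : Type*} (w : List α) (i : ℕ) : (wpow w i).length = i * w.length := by
  simp [wpow]

theorem isChain_map_const {α : Type*} (w : List α) (c : Bool) :
    FreeGroup.IsReduced (w.map fun a => (a, c)) := by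
  unfold FreeGroup.IsReduced
  rw [List.isChain_map]
  induction w with
  | nil => simp
  | cons a w ih => cases w <;> simp_all

theorem norm_del {α : Type*} [DecidableEq α] (a b : α) (s t : List α) (hab : a ≠ b) :
    (del (a :: s) (b :: t)).norm = s.length + t.length + 2 := by
  have h : del (a :: s) (b :: t) = FreeGroup.mk (((a :: s).reverse.map fun a => (a, false)) ++
      ((b :: t).map fun a => (a, true))) := by
    rw [del, iota_eq, iota_eq, FreeGroup.inv_mk, FreeGroup.mul_mk]
    simp [FreeGroup.invRev, Function.comp_def]
  have hr : FreeGroup.IsReduced (((a :: s).reverse.map fun a => (a, false)) ++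
      ((b :: t).map fun a => (a, true))) := by
    have h1 := isChain_map_const (a :: s).reverse false
    have h2 := isChain_map_const (b :: t) true
    unfold FreeGroup.IsReduced at *
    rw [List.isChain_append]
    refine ⟨h1, h2, ?_⟩
    simp [hab]
  rw [h, FreeGroup.norm, FreeGroup.toWord_mk, hr.reduce_eq]
  simp
  omega

theorem exists_split {α : Type*} (v w : List α) (h₁ : ¬ v <+: w) (h₂ : ¬ w <+: v) :
    ∃ p a b s t, a ≠ b ∧ v = p ++ a :: s ∧ w = p ++ b :: t := by
  induction v generalizing w with
  | nil => simp at h₁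
  | cons x v ih =>
    cases w with
    | nil => simp at h₂
    | cons y w =>
      by_cases hxy : x = y
      · subst hxy
        rw [List.cons_prefix_cons] at h₁ h₂
        obtain ⟨p, a, b, s, t, hab, h, h'⟩ := ih w (by tauto) (by tauto)
        exact ⟨x :: p, a, b, s, t, hab, by simp [h], by simp [h']⟩
      · exact ⟨[], x, y, v, w, hxy, rfl, rfl⟩

theorem delay_incomparable_prefixes {α : Type*} (v₁ w₁ v₂ w₂ : List α)
    (h₁ : ¬ v₁ <+: w₁) (h₂ : ¬ w₁ <+: v₁)
    (h₃ : ¬ (v₂ = [] ∧ w₂ = [])) :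
    ∀ i j : ℕ, i < j →
      del (v₁ ++ wpow v₂ i) (w₁ ++ wpow w₂ i) ≠
        del (v₁ ++ wpow v₂ j) (w₁ ++ wpow w₂ j) := by
  classical
  obtain ⟨p, a, b, s, t, hab, rfl, rfl⟩ := exists_split v₁ w₁ h₁ h₂
  intro i j hij h
  have h' := congrArg FreeGroup.norm h
  simp only [List.append_assoc, List.cons_append, del_append, norm_del _ _ _ _ hab,
    List.length_append, wpow_length] at h'
  have h4 : 0 < v₂.length + w₂.length := by
    by_contra hc
    exact h₃ ⟨List.length_eq_zero_iff.1 (by omega), List.length_eq_zero_iff.1 (by omega)⟩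
  nlinarith [Nat.mul_lt_mul_of_pos_right hij h4]
end

section
/- Let Q be a finite type and let m be a relation on Q (a subset of Q × Q) that is idempotent for relation composition, i.e., m ∘ m = m, where (x,z) ∈ m ∘ m iff there exists y with (x,y) ∈ m and (y,z) ∈ m. Then for every pair (q₁, q₂) ∈ m there exists q ∈ Q such that (q₁, q) ∈ m, (q, q) ∈ m, and (q, q₂) ∈ m. -/
theorem idempotent_relation_z_form {Q : Type*} [Finite Q]
    (m : Q → Q → Prop) (hm : Relation.Comp m m = m)
    (q₁ q₂ : Q) (h : m q₁ q₂) :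
    ∃ q : Q, m q₁ q ∧ m q q ∧ m q q₂ := by
  have tr : ∀ {a b c}, m a b → m b c → m a c := by
    intro a b c h1 h2
    rw [← hm]
    exact ⟨b, h1, h2⟩
  have dn : ∀ {a c}, m a c → ∃ b, m a b ∧ m b c := by
    intro a c h1
    rw [← hm] at h1
    exact h1
  let r : Q → Q → Prop := fun a b => m a b ∧ ¬ m b a
  haveI : IsTrans Q r := ⟨fun a b c h1 h2 =>
    ⟨tr h1.1 h2.1, fun h3 => h1.2 (tr h2.1 h3)⟩⟩
  haveI : Std.Irrefl r := ⟨fun a h1 => h1.2 h1.1⟩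
  have wf : WellFounded r := Finite.wellFounded_of_trans_of_irrefl r
  have key : ∀ x, m q₁ x → m x q₂ → ∃ q : Q, m q₁ q ∧ m q q ∧ m q q₂ := by
    intro x
    induction x using wf.induction with
    | _ x ih =>
      intro h1 h2
      obtain ⟨y, hy1, hy2⟩ := dn h1
      by_cases hxy : m x y
      · exact ⟨x, h1, tr hxy hy2, h2⟩
      · exact ih y ⟨hy2, hxy⟩ hy1 (tr hy2 h2)
  obtain ⟨y, h1, h2⟩ := dn h
  exact key y h1 h2
end

section
/- Let Q be a finite type and let m be a relation on Q that is idempotent for relation composition (m ∘ m = m) and is not an s-form, i.e., there do not exist distinct q, q' ∈ Q with (q,q) ∈ m, (q,q') ∈ m and (q',q') ∈ m. If q₁, q₂, q₂', q₃ ∈ Q satisfy (q₁, q₂) ∈ m, (q₂, q₂') ∈ m and (q₂', q₃) ∈ m, then q₂ = q₂'. -/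
theorem exists_loop_between {Q : Type*} [Finite Q]
    (m : Q → Q → Prop) (hm : Relation.Comp m m = m) (a b : Q) (h : m a b) :
    ∃ p, m a p ∧ m p p ∧ m p b := by
  have tr : ∀ x y z, m x y → m y z → m x z := fun x y z h1 h2 => by
    rw [← hm]; exact ⟨y, h1, h2⟩
  have de : ∀ x z, m x z → ∃ y, m x y ∧ m y z := fun x z h1 => by
    rw [← hm] at h1; exact h1
  by_contra hno
  push Not at hno
  let S := {x : Q // m a x ∧ m x b}
  let r : S → S → Prop := fun x y => m y.1 x.1
  haveI : IsTrans S r := ⟨fun x y z h1 h2 => tr _ _ _ h2 h1⟩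
  haveI : Std.Irrefl r := ⟨fun x hx => hno x.1 x.2.1 hx x.2.2⟩
  have wf : WellFounded r := Finite.wellFounded_of_trans_of_irrefl r
  obtain ⟨y, hy⟩ := de a b h
  obtain ⟨x, -, hx⟩ := wf.has_min Set.univ ⟨(⟨y, hy⟩ : S), trivial⟩
  obtain ⟨z, hz1, hz2⟩ := de x.1 b x.2.2
  exact hx ⟨z, tr _ _ _ x.2.1 hz1, hz2⟩ trivial hz1

theorem idempotent_no_s_form_loop {Q : Type*} [Finite Q]
    (m : Q → Q → Prop) (hm : Relation.Comp m m = m)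
    (hsform : ¬ ∃ q q' : Q, q ≠ q' ∧ m q q ∧ m q q' ∧ m q' q')
    (q₁ q₂ q₂' q₃ : Q)
    (h₁ : m q₁ q₂) (h₂ : m q₂ q₂') (h₃ : m q₂' q₃) :
    q₂ = q₂' := by
  have tr : ∀ x y z, m x y → m y z → m x z := fun x y z h1 h2 => by
    rw [← hm]; exact ⟨y, h1, h2⟩
  have key : ∀ x y, m x x → m x y → m y y → x = y := fun x y h1 h2 h3 => by
    by_contra hne
    exact hsform ⟨x, y, hne, h1, h2, h3⟩
  obtain ⟨p, -, hp, hp2⟩ := exists_loop_between m hm _ _ h₁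
  obtain ⟨r, hr1, hr, hr2⟩ := exists_loop_between m hm _ _ h₂
  obtain ⟨s, hs1, hs, -⟩ := exists_loop_between m hm _ _ h₃
  have e1 : p = r := key _ _ hp (tr _ _ _ hp2 hr1) hr
  have e2 : r = s := key _ _ hr (tr _ _ _ hr2 hs1) hs
  subst e1 e2
  exact key _ _ (tr _ _ _ hr1 hp2) h₂ (tr _ _ _ hs1 hr2)
end

section
/- Let M be a finite monoid. There exists a natural number C such that for every sequence m₁, m₂, …, m_C of C elements of M, there exist indices 1 ≤ i₁ < i₂ < i₃ < i₄ ≤ C + 1 such that the three products m_{i₁} · m_{i₁+1} ⋯ m_{i₂−1}, m_{i₂} · m_{i₂+1} ⋯ m_{i₃−1}, and m_{i₃} · m_{i₃+1} ⋯ m_{i₄−1} are all equal to a common element e of M satisfying e · e = e (i.e., e is idempotent). -/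
theorem ramsey_aux {M : Type*} [Fintype M] [DecidableEq M] [Nonempty M] (n : ℕ) :
    ∀ k : M → ℕ, ∑ e, k e = n → ∃ N : ℕ, ∀ (c : ℕ → ℕ → M) (S : Finset ℕ), N ≤ S.card →
      ∃ e, ∃ T ⊆ S, T.card = k e ∧ ∀ a ∈ T, ∀ b ∈ T, a < b → c a b = e := by
  induction n with
  | zero =>
    intro k hk
    refine ⟨0, fun c S _ => ⟨Classical.arbitrary M, ∅, by simp, ?_, by simp⟩⟩
    have := (Finset.sum_eq_zero_iff.1 hk) (Classical.arbitrary M) (Finset.mem_univ _)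
    simp [this]
  | succ n ih =>
    intro k hk
    by_cases h0 : ∃ e, k e = 0
    · obtain ⟨e, he⟩ := h0
      exact ⟨0, fun c S _ => ⟨e, ∅, by simp, by simp [he], by simp⟩⟩
    push Not at h0
    have h1 : ∀ e, ∑ x, (Function.update k e (k e - 1)) x = n := by
      intro e
      have h2 := Finset.sum_update_of_mem (Finset.mem_univ e) k (k e - 1)
      have h3 := Finset.sum_eq_add_sum_sdiff_singleton_of_mem (Finset.mem_univ e) k
      have := h0 e
      omega
    choose N hN using fun e => ih _ (h1 e)
    refine ⟨∑ e, N e + 1, fun c S hS => ?_⟩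
    have hne : S.Nonempty := Finset.card_pos.1 (by omega)
    set a := S.min' hne with ha
    have haS : a ∈ S := S.min'_mem hne
    have hc : (S.erase a).card = S.card - 1 := Finset.card_erase_of_mem haS
    have hf := Finset.card_eq_sum_card_fiberwise (s := S.erase a) (t := Finset.univ)
      (f := fun x => c a x) (fun _ _ => by simp)
    obtain ⟨e, -, he⟩ : ∃ e ∈ (Finset.univ : Finset M),
        N e ≤ ((S.erase a).filter (fun x => c a x = e)).card :=
      Finset.exists_le_of_sum_le Finset.univ_nonempty (by rw [← hf]; omega)
    obtain ⟨d, T, hT, hTc, hTm⟩ := hN e c _ he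
    have hTS : ∀ x ∈ T, x ∈ S ∧ a < x ∧ c a x = e := by
      intro x hx
      have := hT hx
      simp only [Finset.mem_filter, Finset.mem_erase] at this
      exact ⟨this.1.2, lt_of_le_of_ne (S.min'_le x this.1.2) (Ne.symm this.1.1), this.2⟩
    by_cases hde : d = e
    · subst hde
      refine ⟨d, insert a T, ?_, ?_, ?_⟩
      · intro x hx
        rcases Finset.mem_insert.1 hx with rfl | hx
        · exact haS
        · exact (hTS x hx).1
      · rw [Finset.card_insert_of_notMem (fun h => lt_irrefl _ (hTS a h).2.1), hTc]
        have := h0 d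
        simp
        omega
      · intro x hx y hy hxy
        rcases Finset.mem_insert.1 hx with hx | hx <;> rcases Finset.mem_insert.1 hy with hy | hy
        · omega
        · rw [hx]; exact (hTS y hy).2.2
        · have := (hTS x hx).2.1
          omega
        · exact hTm x hx y hy hxy
    · exact ⟨d, T, fun x hx => (hTS x hx).1, by rw [hTc, Function.update_of_ne hde], hTm⟩

theorem ramsey_idempotent_factorisation {M : Type*} [Monoid M] [Finite M] :
    ∃ C : ℕ, ∀ m : ℕ → M,
      ∃ i₁ i₂ i₃ i₄ : ℕ,
        1 ≤ i₁ ∧ i₁ < i₂ ∧ i₂ < i₃ ∧ i₃ < i₄ ∧ i₄ ≤ C + 1 ∧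
        ∃ e : M, e * e = e ∧
          ((List.Ico i₁ i₂).map m).prod = e ∧
          ((List.Ico i₂ i₃).map m).prod = e ∧
          ((List.Ico i₃ i₄).map m).prod = e := by
  classical
  have := Fintype.ofFinite M
  obtain ⟨N, hN⟩ := ramsey_aux (M := M) _ (fun _ => 4) rfl
  refine ⟨N, fun m => ?_⟩
  obtain ⟨e, T, hT, hc, hm⟩ := hN (fun i j => ((List.Ico i j).map m).prod)
    (Finset.Icc 1 (N + 1)) (by simp)
  let f := T.orderEmbOfFin hc
  have hf : ∀ i, f i ∈ T := T.orderEmbOfFin_mem hc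
  have h01 : f 0 < f 1 := f.strictMono (by decide)
  have h12 : f 1 < f 2 := f.strictMono (by decide)
  have h23 : f 2 < f 3 := f.strictMono (by decide)
  have e01 := hm _ (hf 0) _ (hf 1) h01
  have e12 := hm _ (hf 1) _ (hf 2) h12
  have e02 := hm _ (hf 0) _ (hf 2) (h01.trans h12)
  refine ⟨f 0, f 1, f 2, f 3, (Finset.mem_Icc.1 (hT (hf 0))).1, h01, h12, h23,
    (Finset.mem_Icc.1 (hT (hf 3))).2, e, ?_, e01, e12, hm _ (hf 2) _ (hf 3) h23⟩
  rw [← List.Ico.append_consecutive h01.le h12.le, List.map_append, List.prod_append,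
    e01, e12] at e02
  exact e02
end

section
/- Let A be a nondeterministic finite automaton with finite state set Q of cardinality n over an alphabet Σ, with initial states I ⊆ Q, final states F ⊆ Q and transition relation Δ ⊆ Q × Σ × Q, and suppose A is m-ambiguous, i.e., #_A(w) ≤ m for every word w. Let N be a natural number with N > n^m · 2^n, and let u₁, …, u_N be nonempty words over Σ. Then there exist indices ℓ₁ ≤ ℓ₂ in {1, …, N} such that for every i ≥ 1, #_A(u₁ ⋯ u_{ℓ₁−1} ++ (u_{ℓ₁} ⋯ u_{ℓ₂})^i ++ u_{ℓ₂+1} ⋯ u_N) = #_A(u₁ ⋯ u_N), where (u_{ℓ₁} ⋯ u_{ℓ₂})^i denotes the i-fold concatenation of the word u_{ℓ₁} ⋯ u_{ℓ₂} with itself. -/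
/-- An accepting run of an NFA (with initial states `I`, final states `F`
and transition relation `Δ`) on the word `w`, given as the sequence of
`w.length + 1` visited states. -/
def IsAccRun {Q A : Type*} (I F : Set Q) (Δ : Set (Q × A × Q))
    (w : List A) (ρ : Fin (w.length + 1) → Q) : Prop :=
  ρ 0 ∈ I ∧ ρ (Fin.last w.length) ∈ F ∧
    ∀ i : Fin w.length, (ρ i.castSucc, w.get i, ρ i.succ) ∈ Δ

/-- The number of accepting runs of the NFA on the word `w`. -/
noncomputable def numAccRuns {Q A : Type*} (I F : Set Q) (Δ : Set (Q × A × Q))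
    (w : List A) : ℕ :=
  Nat.card { ρ : Fin (w.length + 1) → Q // IsAccRun I F Δ w ρ }

/-- The concatenation of the words `u i` for `a ≤ i < b`. -/
def catIco {A : Type*} (u : ℕ → List A) (a b : ℕ) : List A :=
  ((List.Ico a b).map u).flatten

theorem npos_mul_iff {a b : ℕ} : 0 < a * b ↔ 0 < a ∧ 0 < b := by
  simp [Nat.pos_iff_ne_zero]

open Classical in
/-- Path-count matrix of a word. -/
noncomputable def pcm {Q A : Type*} [Fintype Q] (Δ : Set (Q × A × Q)) : List A → Matrix Q Q ℕ
  | [] => 1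
  | a :: w => (Matrix.of fun p q => if (p, a, q) ∈ Δ then 1 else 0) * pcm Δ w

theorem pcm_append {Q A : Type*} [Fintype Q] (Δ : Set (Q × A × Q)) (v w : List A) :
    pcm Δ (v ++ w) = pcm Δ v * pcm Δ w := by
  induction v with
  | nil => simp [pcm]
  | cons a v ih => simp [pcm, ih, Matrix.mul_assoc]

theorem pcm_replicate {Q A : Type*} [Fintype Q] [DecidableEq Q] (Δ : Set (Q × A × Q))
    (v : List A) (i : ℕ) :
    pcm Δ (List.replicate i v).flatten = (pcm Δ v) ^ i := by
  induction i with
  | zero =>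
    rw [pow_zero]
    ext p q
    simp [pcm, Matrix.one_apply]
  | succ i ih =>
    rw [List.replicate_succ, List.flatten_cons, pcm_append, ih]
    rw [pow_succ']

open Classical in
noncomputable def ind {Q : Type*} (I : Set Q) : Q → ℕ := fun q => if q ∈ I then 1 else 0

open Classical in
theorem numAccRuns_nil {Q A : Type*} [Fintype Q] (I F : Set Q) (Δ : Set (Q × A × Q)) :
    numAccRuns I F Δ [] = ∑ q, ind I q * ind F q := by
  have e : { ρ : Fin (([] : List A).length + 1) → Q // IsAccRun I F Δ [] ρ } ≃
      {q : Q // q ∈ I ∧ q ∈ F} :=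
    { toFun := fun ρ => ⟨ρ.1 0, ρ.2.1, ρ.2.2.1⟩
      invFun := fun q => ⟨fun _ => q.1, q.2.1, q.2.2, fun i => i.elim0⟩
      left_inv := by
        rintro ⟨ρ, h⟩
        apply Subtype.ext
        funext i
        have : i = 0 := Subsingleton.elim (α := Fin 1) _ _
        rw [this]
      right_inv := fun q => rfl }
  unfold numAccRuns
  rw [Nat.card_congr e, Nat.card_eq_fintype_card, Fintype.card_subtype, Finset.card_filter]
  apply Finset.sum_congr rfl
  intro q _
  unfold ind
  by_cases h1 : q ∈ I <;> by_cases h2 : q ∈ F <;> simp [h1, h2]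

open Classical in
theorem numAccRuns_cons {Q A : Type*} [Fintype Q] (I F : Set Q) (Δ : Set (Q × A × Q))
    (a : A) (w : List A) :
    numAccRuns I F Δ (a :: w) = ∑ p, ind I p * numAccRuns {q | (p, a, q) ∈ Δ} F Δ w := by
  have e : { ρ : Fin ((a :: w).length + 1) → Q // IsAccRun I F Δ (a :: w) ρ } ≃
      (Σ p : {p : Q // p ∈ I},
        { ρ : Fin (w.length + 1) → Q // IsAccRun {q | (p.1, a, q) ∈ Δ} F Δ w ρ }) :=
    { toFun := fun ρ => ⟨⟨ρ.1 0, ρ.2.1⟩, ⟨fun i => ρ.1 i.succ, ρ.2.2.2 0, ρ.2.2.1,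
          fun i => ρ.2.2.2 i.succ⟩⟩
      invFun := fun x => ⟨(Fin.cons x.1.1 x.2.1 : Fin (w.length + 1 + 1) → Q), x.1.2, x.2.2.2.1, by
          intro i
          refine Fin.cases ?_ (fun j => ?_) i
          · exact x.2.2.1
          · exact x.2.2.2.2 j⟩
      left_inv := by
        rintro ⟨ρ, h⟩
        apply Subtype.ext
        funext i
        refine Fin.cases ?_ (fun j => ?_) i <;> rfl
      right_inv := fun x => rfl }
  unfold numAccRuns
  rw [Nat.card_congr e, Nat.card_sigma]
  unfold ind
  simp only [ite_mul, one_mul, zero_mul]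
  rw [← Finset.sum_filter]
  exact (Finset.sum_subtype (p := fun p => p ∈ I) (Finset.univ.filter (fun p => p ∈ I)) (fun x => by simp)
    (fun p => Nat.card { ρ : Fin (w.length + 1) → Q // IsAccRun {q | (p, a, q) ∈ Δ} F Δ w ρ })).symm

open Matrix in
theorem numAccRuns_eq {Q A : Type*} [Fintype Q] (I F : Set Q) (Δ : Set (Q × A × Q))
    (w : List A) :
    numAccRuns I F Δ w = ind I ⬝ᵥ (pcm Δ w *ᵥ ind F) := by
  classical
  induction w generalizing I with
  | nil =>
    rw [numAccRuns_nil]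
    have : pcm Δ ([] : List A) = 1 := by ext p q; simp [pcm, Matrix.one_apply]
    rw [this, Matrix.one_mulVec]; rfl
  | cons a w ih =>
    rw [numAccRuns_cons]
    simp only [ih]
    rw [pcm, ← Matrix.mulVec_mulVec]
    rfl

/-- Paths indexed by naturals. -/
def IsPth {Q A : Type*} (Δ : Set (Q × A × Q)) (w : List A) (ρ : ℕ → Q) : Prop :=
  ∀ i (h : i < w.length), (ρ i, w[i], ρ (i + 1)) ∈ Δ

theorem exists_pth {Q A : Type*} [Fintype Q] (Δ : Set (Q × A × Q)) (w : List A) (p q : Q)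
    (h : 0 < pcm Δ w p q) : ∃ ρ, IsPth Δ w ρ ∧ ρ 0 = p ∧ ρ w.length = q := by
  classical
  induction w generalizing p with
  | nil =>
    have hpq : p = q := by
      by_contra hne
      simp [pcm, Matrix.one_apply, hne] at h
    exact ⟨fun _ => p, fun i h => by simp at h, rfl, hpq⟩
  | cons a w ih =>
    rw [pcm, Matrix.mul_apply] at h
    obtain ⟨r, _, hr⟩ := Finset.sum_pos_iff.1 h
    simp only [Matrix.of_apply] at hr
    obtain ⟨h1, h2⟩ := npos_mul_iff.1 hr
    have h1' : (p, a, r) ∈ Δ := by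
      by_contra hne
      simp [hne] at h1
    obtain ⟨ρ, h3, h4, h5⟩ := ih r h2
    refine ⟨fun i => Nat.casesOn i p ρ, ?_, rfl, h5⟩
    intro i hi
    cases i with
    | zero => simpa [h4] using h1'
    | succ j => simpa using h3 j (by simpa using hi)

theorem pth_append {Q A : Type*} (Δ : Set (Q × A × Q)) (v w : List A) (ρ σ : ℕ → Q)
    (h1 : IsPth Δ v ρ) (h2 : IsPth Δ w σ) (h : ρ v.length = σ 0) :
    ∃ τ, IsPth Δ (v ++ w) τ ∧ (∀ i ≤ v.length, τ i = ρ i) ∧ ∀ i, τ (v.length + i) = σ i := by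
  have key : ∀ i, (if v.length + i ≤ v.length then ρ (v.length + i) else σ (v.length + i - v.length)) = σ i := by
    intro i
    by_cases hi : i = 0
    · subst hi; simpa using h
    · rw [if_neg (by omega)]; congr 1; omega
  refine ⟨fun i => if i ≤ v.length then ρ i else σ (i - v.length), ?_, ?_, key⟩
  · intro i hi
    by_cases hv : i < v.length
    · simpa [hv, hv.le, Nat.succ_le_of_lt hv] using h1 i hv
    · obtain ⟨j, rfl⟩ := Nat.exists_eq_add_of_le (not_lt.1 hv)
      have hj : j < w.length := by simpa using hi
      have e1 := key j
      have e2 := key (j + 1)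
      rw [← Nat.add_assoc] at e2
      dsimp only
      rw [e1, e2]
      simpa using h2 j hj
  · intro i hi
    simp [hi]

theorem ind_pos {Q : Type*} {I : Set Q} {q : Q} (h : 0 < ind I q) : q ∈ I := by
  by_contra hne
  simp [ind, hne] at h

open Matrix in
/-- Existence of an accepting run through prescribed states. -/
theorem exists_run {Q A : Type*} [Fintype Q] (I F : Set Q) (Δ : Set (Q × A × Q))
    (x v y : List A) (p q : Q) (h1 : 0 < (ind I ᵥ* pcm Δ x) p) (h2 : 0 < pcm Δ v p q)
    (h3 : 0 < (pcm Δ y *ᵥ ind F) q) (W : List A) (hW : W = x ++ v ++ y) :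
    ∃ ρ : Fin (W.length + 1) → Q, IsAccRun I F Δ W ρ ∧
      (∀ k : Fin (W.length + 1), k.1 = x.length → ρ k = p) ∧
      (∀ k : Fin (W.length + 1), k.1 = (x ++ v).length → ρ k = q) := by
  subst hW
  obtain ⟨s, _, hs⟩ := Finset.sum_pos_iff.1 h1
  obtain ⟨t, _, ht⟩ := Finset.sum_pos_iff.1 h3
  obtain ⟨hs1, hs2⟩ := npos_mul_iff.1 hs
  obtain ⟨ht1, ht2⟩ := npos_mul_iff.1 ht
  obtain ⟨ρ1, a1, a2, a3⟩ := exists_pth Δ x s p hs2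
  obtain ⟨ρ2, b1, b2, b3⟩ := exists_pth Δ v p q h2
  obtain ⟨ρ3, c1, c2, c3⟩ := exists_pth Δ y q t ht1
  obtain ⟨τ, d1, d2, d3⟩ := pth_append Δ x v ρ1 ρ2 a1 b1 (by rw [a3, b2])
  have e0 : τ (x ++ v).length = q := by rw [List.length_append, d3, b3]
  obtain ⟨σ, e1, e2, e3⟩ := pth_append Δ (x ++ v) y τ ρ3 d1 c1 (by rw [c2, e0])
  refine ⟨fun k => σ k.1, ⟨?_, ?_, ?_⟩, ?_, ?_⟩
  · show σ 0 ∈ I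
    rw [e2 _ (by simp), d2 _ (by simp), a2]; exact ind_pos hs1
  · show σ (x ++ v ++ y).length ∈ F
    rw [List.length_append (as := x ++ v), e3, c3]; exact ind_pos ht2
  · intro i
    exact e1 i.1 i.2
  · intro k hk
    show σ k.1 = p
    rw [hk, e2 _ (by simp), d2 _ le_rfl, a3]
  · intro k hk
    show σ k.1 = q
    rw [hk, e2 _ le_rfl, e0]

open Matrix in
theorem algebra_core {Q : Type*} [Fintype Q] [DecidableEq Q] (α β : Q → ℕ) (M : Matrix Q Q ℕ)
    (m : ℕ) (hE : ∀ p q, 0 < α p → 0 < M p q → 0 < β q → p = q)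
    (hS : ∀ q, 0 < (α ᵥ* M) q ↔ 0 < α q)
    (hm : ∀ i : ℕ, (α ᵥ* M ^ i) ⬝ᵥ β ≤ m) (i : ℕ) :
    (α ᵥ* M ^ i) ⬝ᵥ β = α ⬝ᵥ β := by
  have supp : ∀ i q, 0 < (α ᵥ* M ^ i) q ↔ 0 < α q := by
    intro i
    induction i with
    | zero => simp
    | succ i ih =>
      intro q
      rw [← hS q, pow_succ, ← Matrix.vecMul_vecMul]
      simp only [Matrix.vecMul, dotProduct, Finset.sum_pos_iff, npos_mul_iff] at ih ⊢
      simp only [ih]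
  have step : ∀ i q, 0 < β q → (α ᵥ* M ^ i) q = α q * M q q ^ i := by
    intro i q hq
    induction i with
    | zero => simp
    | succ i ih =>
      rw [pow_succ, ← Matrix.vecMul_vecMul]
      show ∑ p, (α ᵥ* M ^ i) p * M p q = _
      rw [Finset.sum_eq_single q, ih, pow_succ, mul_assoc]
      · intro p _ hpq
        by_contra hne
        obtain ⟨h1, h2⟩ := npos_mul_iff.1 (Nat.pos_of_ne_zero hne)
        exact hpq (hE p q ((supp i p).1 h1) h2 hq)
      · simp
  have one : ∀ q, 0 < β q → 0 < α q → M q q = 1 := by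
    intro q hb ha
    have h1 : 0 < M q q := by
      have := (hS q).2 ha
      have h2 := step 1 q hb
      rw [pow_one, pow_one] at h2
      rw [h2] at this
      exact (npos_mul_iff.1 this).2
    by_contra hne
    have h2 : 2 ≤ M q q := by omega
    have h3 : (α ᵥ* M ^ m) q * β q ≤ m :=
      (Finset.single_le_sum (f := fun q => (α ᵥ* M ^ m) q * β q)
        (fun _ _ => Nat.zero_le _) (Finset.mem_univ q)).trans (hm m)
    rw [step m q hb] at h3
    have h4 : m < 2 ^ m := Nat.lt_two_pow_self
    have h5 : 2 ^ m ≤ M q q ^ m := Nat.pow_le_pow_left h2 m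
    have h6 : M q q ^ m ≤ α q * M q q ^ m := Nat.le_mul_of_pos_left _ ha
    have h7 : α q * M q q ^ m ≤ α q * M q q ^ m * β q := Nat.le_mul_of_pos_right _ hb
    omega
  apply Finset.sum_congr rfl
  intro q _
  rcases Nat.eq_zero_or_pos (β q) with hb | hb
  · rw [hb]; simp
  · rw [step i q hb]
    rcases Nat.eq_zero_or_pos (α q) with ha | ha
    · rw [ha]; simp
    · rw [one q hb ha]; simp

theorem catIco_append {A : Type*} (u : ℕ → List A) {a b c : ℕ} (h1 : a ≤ b) (h2 : b ≤ c) :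
    catIco u a b ++ catIco u b c = catIco u a c := by
  unfold catIco
  rw [← List.flatten_append, ← List.map_append, List.Ico.append_consecutive h1 h2]

theorem finitely_ambiguous_pumping {Q A : Type*} [Fintype Q]
    (I F : Set Q) (Δ : Set (Q × A × Q)) (m : ℕ)
    (hamb : ∀ w : List A, numAccRuns I F Δ w ≤ m)
    (N : ℕ) (hN : (Fintype.card Q) ^ m * 2 ^ (Fintype.card Q) < N)
    (u : ℕ → List A) (hu : ∀ i, 1 ≤ i → i ≤ N → u i ≠ []) :
    ∃ l₁ l₂ : ℕ, 1 ≤ l₁ ∧ l₁ ≤ l₂ ∧ l₂ ≤ N ∧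
      ∀ i : ℕ, 1 ≤ i →
        numAccRuns I F Δ
          (catIco u 1 l₁ ++ (List.replicate i (catIco u l₁ (l₂ + 1))).flatten ++
            catIco u (l₂ + 1) (N + 1)) =
        numAccRuns I F Δ (catIco u 1 (N + 1)) := by
  classical
  set W := catIco u 1 (N + 1) with hW
  have hsplit : ∀ j : ℕ, j ≤ N → catIco u 1 (j + 1) ++ catIco u (j + 1) (N + 1) = W :=
    fun j hj => catIco_append u (by omega) (by omega)
  have hlen : ∀ j : ℕ, j ≤ N → (catIco u 1 (j + 1)).length < W.length + 1 := by
    intro j hj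
    rw [← hsplit j hj, List.length_append]; omega
  let R := { ρ : Fin (W.length + 1) → Q // IsAccRun I F Δ W ρ }
  let f : Fin (N + 1) → (R → Q) × Set Q := fun j =>
    (fun ρ => ρ.1 ⟨(catIco u 1 (j.1 + 1)).length, hlen j.1 (by omega)⟩,
      {q | 0 < (Matrix.vecMul (ind I) (pcm Δ (catIco u 1 (j.1 + 1)))) q})
  have hR : Fintype.card R ≤ m := by
    rw [← Nat.card_eq_fintype_card]; exact hamb W
  have hcard : Fintype.card ((R → Q) × Set Q) < Fintype.card (Fin (N + 1)) := by
    rw [Fintype.card_prod, Fintype.card_fun, Fintype.card_set, Fintype.card_fin]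
    rcases Nat.eq_zero_or_pos (Fintype.card Q) with h0 | h0
    · have : IsEmpty Q := Fintype.card_eq_zero_iff.1 h0
      have : IsEmpty R := ⟨fun ρ => isEmptyElim (ρ.1 0)⟩
      have : Fintype.card R = 0 := Fintype.card_eq_zero
      rw [this, h0]; simp; omega
    · have : Fintype.card Q ^ Fintype.card R ≤ Fintype.card Q ^ m := Nat.pow_le_pow_right h0 hR
      have := Nat.mul_le_mul_right (2 ^ Fintype.card Q) this
      omega
  obtain ⟨i, j, hij, hf⟩ : ∃ i j : Fin (N + 1), i < j ∧ f i = f j := by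
    obtain ⟨i, j, hne, hf⟩ := Fintype.exists_ne_map_eq_of_card_lt f hcard
    rcases lt_or_gt_of_ne hne with h | h
    · exact ⟨i, j, h, hf⟩
    · exact ⟨j, i, h, hf.symm⟩
  have hij' : i.1 < j.1 := hij
  have hjN : j.1 ≤ N := by omega
  refine ⟨i.1 + 1, j.1, by omega, by omega, hjN, ?_⟩
  have hxv : catIco u 1 (i.1 + 1) ++ catIco u (i.1 + 1) (j.1 + 1) = catIco u 1 (j.1 + 1) :=
    catIco_append u (by omega) (by omega)
  have hfull : W = catIco u 1 (i.1 + 1) ++ catIco u (i.1 + 1) (j.1 + 1) ++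
      catIco u (j.1 + 1) (N + 1) := by
    rw [hxv, hsplit j.1 hjN]
  have hf1 := congrArg Prod.fst hf
  have hf2 := congrArg Prod.snd hf
  simp only [f] at hf1 hf2
  rw [← hxv] at hf2
  rw [pcm_append, ← Matrix.vecMul_vecMul] at hf2
  have hlj : (catIco u 1 (j.1 + 1)).length =
      (catIco u 1 (i.1 + 1) ++ catIco u (i.1 + 1) (j.1 + 1)).length := by rw [hxv]
  have hformula : ∀ k : ℕ, numAccRuns I F Δ (catIco u 1 (i.1 + 1) ++
      (List.replicate k (catIco u (i.1 + 1) (j.1 + 1))).flatten ++ catIco u (j.1 + 1) (N + 1)) =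
      dotProduct (Matrix.vecMul (Matrix.vecMul (ind I) (pcm Δ (catIco u 1 (i.1 + 1))))
        (pcm Δ (catIco u (i.1 + 1) (j.1 + 1)) ^ k))
        (Matrix.mulVec (pcm Δ (catIco u (j.1 + 1) (N + 1))) (ind F)) := by
    intro k
    rw [numAccRuns_eq, pcm_append, pcm_append, pcm_replicate, ← Matrix.mulVec_mulVec,
      Matrix.dotProduct_mulVec, Matrix.vecMul_vecMul]
  have hcore := algebra_core (Matrix.vecMul (ind I) (pcm Δ (catIco u 1 (i.1 + 1))))
    (Matrix.mulVec (pcm Δ (catIco u (j.1 + 1) (N + 1))) (ind F))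
    (pcm Δ (catIco u (i.1 + 1) (j.1 + 1))) m
    (by
      intro p q h1 h2 h3
      obtain ⟨ρ, hρ, e1, e2⟩ := exists_run I F Δ _ _ _ p q h1 h2 h3 W hfull
      have := congrFun hf1 ⟨ρ, hρ⟩
      rw [← e1 ⟨_, hlen i.1 (by omega)⟩ rfl, ← e2 ⟨_, hlen j.1 hjN⟩ hlj]
      exact this)
    (by
      intro q
      have := Set.ext_iff.1 hf2 q
      exact this.symm)
    (by
      intro k
      rw [← hformula k]
      exact hamb _)
  intro k _
  rw [hformula k, hcore k, ← hcore 1, ← hformula 1]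
  congr 1
  rw [hfull]
  simp
end
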